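/- Every point of the complex unit sphere S_ℂ^6 lies in the compact orbit of the slice T_1 = {cosh θ·e_1 + i sinh θ·e_2 : θ ∈ ℝ}: for every v ∈ ℂ^8 with zeroth coordinate v_0 = 0 (i.e. v in the ℂ-span of e_1,…,e_7) and (v,v) = 1, there exist k ∈ G_2 and θ ∈ ℝ such that v = k(cosh θ·e_1 + i sinh θ·e_2). -/

import Mathlib

open Matrix

noncomputable section

/-- The standard basis of the complexified Cayley algebra `𝕆_ℂ = ℂ^8`. -/
def e (i : Fin 8) : Fin 8 → ℂ := Pi.single i 1

/-- The oriented lines of the multiplication table of the Cayley algebra: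
`(i, j, k)` in this list means `e_i e_j = e_k`. -/
def octLines : List (Fin 8 × Fin 8 × Fin 8) :=
  [(1,2,3),(2,3,1),(3,1,2),
   (1,4,5),(4,5,1),(5,1,4),
   (1,6,7),(6,7,1),(7,1,6),
   (2,5,7),(5,7,2),(7,2,5),
   (2,6,4),(6,4,2),(4,2,6),
   (3,5,6),(5,6,3),(6,3,5),
   (3,4,7),(4,7,3),(7,3,4)]

/-- Product of two basis elements of the complexified Cayley algebra. -/
def octBasisMul (i j : Fin 8) : Fin 8 → ℂ :=
  if i = 0 then e j
  else if j = 0 then e i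
  else if i = j then -(e 0)
  else
    match octLines.find? (fun t => t.1 == i && t.2.1 == j) with
    | some t => e t.2.2
    | none =>
      match octLines.find? (fun t => t.1 == j && t.2.1 == i) with
      | some t => -(e t.2.2)
      | none => 0

/-- The bilinear multiplication of the complexified Cayley algebra `𝕆_ℂ`. -/
def octMul (x y : Fin 8 → ℂ) : Fin 8 → ℂ :=
  ∑ i, ∑ j, (x i * y j) • octBasisMul i j

/-- The standard symmetric bilinear form on `ℂ^8`. -/
def bform (v w : Fin 8 → ℂ) : ℂ := ∑ i, v i * w i

/-- `SO(8, ℂ)`. -/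
def SO8 (g : Matrix (Fin 8) (Fin 8) ℂ) : Prop := gᵀ * g = 1 ∧ g.det = 1

/-- A matrix has real entries. -/
def realMat (g : Matrix (Fin 8) (Fin 8) ℂ) : Prop := ∀ i j, (g i j).im = 0

/-- The realization of `G₂(ℂ)` as automorphisms of `𝕆_ℂ`. -/
def inG2 (g : Matrix (Fin 8) (Fin 8) ℂ) : Prop :=
  SO8 g ∧ ∀ x y, g.mulVec (octMul x y) = octMul (g.mulVec x) (g.mulVec y)

/-- The compact real form `G₂`. -/
def inG2cpt (g : Matrix (Fin 8) (Fin 8) ℂ) : Prop := inG2 g ∧ realMat g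

/-- The realization `B₃(ℂ)` of `Spin(7, ℂ)`. -/
def inB3 (g : Matrix (Fin 8) (Fin 8) ℂ) : Prop :=
  SO8 g ∧ ∃ g₀, SO8 g₀ ∧ g₀.mulVec (e 0) = e 0 ∧
    ∀ x y, octMul (g₀.mulVec x) (g.mulVec y) = g.mulVec (octMul x y)

/-- The compact real form `Spin(7)`. -/
def inSpin7 (g : Matrix (Fin 8) (Fin 8) ℂ) : Prop :=
  SO8 g ∧ realMat g ∧ ∃ g₀, SO8 g₀ ∧ realMat g₀ ∧ g₀.mulVec (e 0) = e 0 ∧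
    ∀ x y, octMul (g₀.mulVec x) (g.mulVec y) = g.mulVec (octMul x y)

/-- The one-parameter group `t_θ` (abelian slice `A₁` for `(G₂(ℂ), SL(3,ℂ))`). -/
def tmat (θ : ℝ) : Matrix (Fin 8) (Fin 8) ℂ :=
  Matrix.of fun i j =>
    (![ e 0,
        (Real.cosh θ : ℂ) • e 1 + (Complex.I * (Real.sinh θ : ℂ)) • e 2,
        (-(Complex.I * (Real.sinh θ : ℂ))) • e 1 + (Real.cosh θ : ℂ) • e 2,
        e 3,
        (Real.cosh (θ/2) : ℂ) • e 4 + (-(Complex.I * (Real.sinh (θ/2) : ℂ))) • e 7,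
        (Real.cosh (θ/2) : ℂ) • e 5 + (-(Complex.I * (Real.sinh (θ/2) : ℂ))) • e 6,
        (Complex.I * (Real.sinh (θ/2) : ℂ)) • e 5 + (Real.cosh (θ/2) : ℂ) • e 6,
        (Complex.I * (Real.sinh (θ/2) : ℂ)) • e 4 + (Real.cosh (θ/2) : ℂ) • e 7 ] j) i

/-- The generator `τ₁` of the one-parameter group `A₁`, i.e. `exp (θ τ₁) = t_θ`. -/
def tau1 : Matrix (Fin 8) (Fin 8) ℂ :=
  Matrix.of fun i j =>
    (![ 0,
        Complex.I • e 2,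
        (-Complex.I) • e 1,
        0,
        (-(Complex.I/2)) • e 7,
        (-(Complex.I/2)) • e 6,
        (Complex.I/2) • e 5,
        (Complex.I/2) • e 4 ] j) i

/-- The one-parameter group `ã_θ` (abelian slice `Ã₀` for `(Spin(7,ℂ), G₂(ℂ))`). -/
def atil (θ : ℝ) : Matrix (Fin 8) (Fin 8) ℂ :=
  Matrix.of fun i j =>
    (![ (Real.cosh θ : ℂ) • e 0 + (Complex.I * (Real.sinh θ : ℂ)) • e 1,
        (-(Complex.I * (Real.sinh θ : ℂ))) • e 0 + (Real.cosh θ : ℂ) • e 1,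
        (Real.cosh (θ/3) : ℂ) • e 2 + (-(Complex.I * (Real.sinh (θ/3) : ℂ))) • e 3,
        (Complex.I * (Real.sinh (θ/3) : ℂ)) • e 2 + (Real.cosh (θ/3) : ℂ) • e 3,
        (Real.cosh (θ/3) : ℂ) • e 4 + (-(Complex.I * (Real.sinh (θ/3) : ℂ))) • e 5,
        (Complex.I * (Real.sinh (θ/3) : ℂ)) • e 4 + (Real.cosh (θ/3) : ℂ) • e 5,
        (Real.cosh (θ/3) : ℂ) • e 6 + (-(Complex.I * (Real.sinh (θ/3) : ℂ))) • e 7,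
        (Complex.I * (Real.sinh (θ/3) : ℂ)) • e 6 + (Real.cosh (θ/3) : ℂ) • e 7 ] j) i

/-- The generator `α̃₁` of the one-parameter group `Ã₀`, i.e. `exp (θ α̃₁) = ã_θ`. -/
def alphatil1 : Matrix (Fin 8) (Fin 8) ℂ :=
  Matrix.of fun i j =>
    (![ Complex.I • e 1,
        (-Complex.I) • e 0,
        (-(Complex.I/3)) • e 3,
        (Complex.I/3) • e 2,
        (-(Complex.I/3)) • e 5,
        (Complex.I/3) • e 4,
        (-(Complex.I/3)) • e 7,
        (Complex.I/3) • e 6 ] j) i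

/-- The one-parameter group `a_x` (abelian slice `A₀` for `(SO(7,ℂ), G₂(ℂ))`). -/
def amat (x : ℝ) : Matrix (Fin 8) (Fin 8) ℂ :=
  Matrix.of fun i j =>
    (![ e 0,
        e 1,
        (Real.cosh x : ℂ) • e 2 + (Complex.I * (Real.sinh x : ℂ)) • e 3,
        (-(Complex.I * (Real.sinh x : ℂ))) • e 2 + (Real.cosh x : ℂ) • e 3,
        (Real.cosh x : ℂ) • e 4 + (Complex.I * (Real.sinh x : ℂ)) • e 5,
        (-(Complex.I * (Real.sinh x : ℂ))) • e 4 + (Real.cosh x : ℂ) • e 5,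
        (Real.cosh x : ℂ) • e 6 + (Complex.I * (Real.sinh x : ℂ)) • e 7,
        (-(Complex.I * (Real.sinh x : ℂ))) • e 6 + (Real.cosh x : ℂ) • e 7 ] j) i

/-- The matrix `I₊₋ = diag(1, −1, 1, −1, 1, −1, 1, −1)`. -/
def Ipm : Matrix (Fin 8) (Fin 8) ℂ :=
  Matrix.diagonal ![1, -1, 1, -1, 1, -1, 1, -1]

/-- The anti-holomorphic involution `σ₀(g) = I₊₋ ḡ I₊₋`. -/
def sigma0 (g : Matrix (Fin 8) (Fin 8) ℂ) : Matrix (Fin 8) (Fin 8) ℂ :=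
  Ipm * g.map (starRingEnd ℂ) * Ipm

end

/-- Coordinate formula for the product of the complexified Cayley algebra. -/
theorem octMul_eq (x y : Fin 8 → ℂ) : octMul x y =
    ![x 0 * y 0 - x 1 * y 1 - x 2 * y 2 - x 3 * y 3 - x 4 * y 4 - x 5 * y 5 - x 6 * y 6 - x 7 * y 7,
      x 0 * y 1 + x 1 * y 0 + x 2 * y 3 - x 3 * y 2 + x 4 * y 5 - x 5 * y 4 + x 6 * y 7 - x 7 * y 6,
      x 0 * y 2 + x 2 * y 0 + x 3 * y 1 - x 1 * y 3 + x 5 * y 7 - x 7 * y 5 + x 6 * y 4 - x 4 * y 6,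
      x 0 * y 3 + x 3 * y 0 + x 1 * y 2 - x 2 * y 1 + x 5 * y 6 - x 6 * y 5 + x 4 * y 7 - x 7 * y 4,
      x 0 * y 4 + x 4 * y 0 + x 5 * y 1 - x 1 * y 5 + x 2 * y 6 - x 6 * y 2 + x 7 * y 3 - x 3 * y 7,
      x 0 * y 5 + x 5 * y 0 + x 1 * y 4 - x 4 * y 1 + x 7 * y 2 - x 2 * y 7 + x 6 * y 3 - x 3 * y 6,
      x 0 * y 6 + x 6 * y 0 + x 7 * y 1 - x 1 * y 7 + x 4 * y 2 - x 2 * y 4 + x 3 * y 5 - x 5 * y 3,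
      x 0 * y 7 + x 7 * y 0 + x 1 * y 6 - x 6 * y 1 + x 2 * y 5 - x 5 * y 2 + x 3 * y 4 - x 4 * y 3] := by
  funext m
  fin_cases m <;>
    simp [octMul, Fin.sum_univ_eight, octBasisMul, octLines, e, List.find?] <;> ring

theorem inG2cpt.mul {g h : Matrix (Fin 8) (Fin 8) ℂ} (hg : inG2cpt g) (hh : inG2cpt h) :
    inG2cpt (g * h) := by
  obtain ⟨⟨⟨go, gd⟩, gm⟩, gr⟩ := hg
  obtain ⟨⟨⟨ho, hd⟩, hm⟩, hr⟩ := hh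
  refine ⟨⟨⟨?_, by rw [det_mul, gd, hd, one_mul]⟩, fun x y => ?_⟩, fun i j => ?_⟩
  · rw [transpose_mul, Matrix.mul_assoc, ← Matrix.mul_assoc gᵀ, go, Matrix.one_mul, ho]
  · simp only [← mulVec_mulVec, hm, gm]
  · simp [Matrix.mul_apply, Complex.mul_im, gr _ _, hr _ _]

theorem inG2cpt.transpose {g : Matrix (Fin 8) (Fin 8) ℂ} (hg : inG2cpt g) : inG2cpt gᵀ := by
  obtain ⟨⟨⟨go, gd⟩, gm⟩, gr⟩ := hg
  have go' : g * gᵀ = 1 := mul_eq_one_comm.mp go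
  refine ⟨⟨⟨by simpa using go', by rw [det_transpose, gd]⟩, fun x y => ?_⟩, fun i j => gr j i⟩
  have h := gm (gᵀ *ᵥ x) (gᵀ *ᵥ y)
  simp only [mulVec_mulVec, go', one_mulVec] at h
  rw [← h, mulVec_mulVec, go, one_mulVec]

/-- The matrix acting by `[[c, s], [-s, c]]` on the `(i, j)`-plane and on the `(k, l)`-plane and
fixing the other basis vectors. -/
def doubleRot {R : Type*} [CommRing R] (i j k l : Fin 8) (c s : R) : Matrix (Fin 8) (Fin 8) R :=
  Matrix.of fun a b =>
    if a = i then (if b = i then c else if b = j then s else 0)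
    else if a = j then (if b = i then -s else if b = j then c else 0)
    else if a = k then (if b = k then c else if b = l then s else 0)
    else if a = l then (if b = k then -s else if b = l then c else 0)
    else if a = b then 1 else 0

/-- The planes of some double rotations that are automorphisms of the Cayley algebra. -/
def autPlanes (i j k l : Fin 8) : Prop :=
  (i, j, k, l) ∈ ([(6,7,5,4), (4,5,3,2), (4,6,5,7), (2,3,7,6), (2,4,3,5), (1,2,7,4)] :
    List (Fin 8 × Fin 8 × Fin 8 × Fin 8))

/-- The four indices are pairwise distinct. -/
def planesDisjoint (i j k l : Fin 8) : Prop :=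
  i ≠ j ∧ i ≠ k ∧ i ≠ l ∧ j ≠ k ∧ j ≠ l ∧ k ≠ l

theorem autPlanes.disjoint {i j k l : Fin 8} (h : autPlanes i j k l) :
    planesDisjoint i j k l := by
  simp only [autPlanes, List.mem_cons, Prod.mk.injEq, List.not_mem_nil, or_false] at h
  rcases h with h | h | h | h | h | h <;> obtain ⟨rfl, rfl, rfl, rfl⟩ := h <;>
    simp [planesDisjoint]

theorem sum_ite_ite_mul {R ι : Type*} [CommRing R] [Fintype ι] [DecidableEq ι] {i j : ι}
    (h : i ≠ j) (p q : R) (x : ι → R) :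
    ∑ b, (if b = i then p else if b = j then q else 0) * x b = p * x i + q * x j := by
  have hb : ∀ b, (if b = i then p else if b = j then q else 0) * x b =
      (if b = i then p * x b else 0) + (if b = j then q * x b else 0) := by
    intro b
    split_ifs <;> simp_all
  simp [hb, Finset.sum_add_distrib]

section doubleRot

variable {R : Type*} [CommRing R] {i j k l : Fin 8}

theorem doubleRot_mulVec (h : planesDisjoint i j k l) (c s : R) (x : Fin 8 → R) (a : Fin 8) :
    (doubleRot i j k l c s *ᵥ x) a =
      if a = i then c * x i + s * x j
      else if a = j then -s * x i + c * x j
      else if a = k then c * x k + s * x l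
      else if a = l then -s * x k + c * x l
      else x a := by
  obtain ⟨h1, -, -, -, -, h6⟩ := h
  simp only [mulVec, dotProduct, doubleRot, Matrix.of_apply]
  split_ifs
  · exact sum_ite_ite_mul h1 _ _ _
  · exact sum_ite_ite_mul h1 _ _ _
  · exact sum_ite_ite_mul h6 _ _ _
  · exact sum_ite_ite_mul h6 _ _ _
  · simp

theorem doubleRot_mul (h : planesDisjoint i j k l) (c s c' s' : R) :
    doubleRot i j k l c s * doubleRot i j k l c' s' =
      doubleRot i j k l (c * c' - s * s') (c * s' + s * c') := by
  refine Matrix.ext_of_mulVec_single fun m => ?_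
  generalize (Pi.single m 1 : Fin 8 → R) = x
  funext a
  rw [← mulVec_mulVec]
  simp only [doubleRot_mulVec h]
  obtain ⟨h1, h2, h3, h4, h5, h6⟩ := h
  simp only [h1, h2, h3, h4, h5, h6, h1.symm, h2.symm, h3.symm, h4.symm, h5.symm, h6.symm,
    if_true, if_false]
  split_ifs <;> ring

theorem doubleRot_one_zero : doubleRot i j k l (1 : R) 0 = 1 := by
  ext a b
  simp only [doubleRot, Matrix.of_apply, Matrix.one_apply]
  grind

theorem doubleRot_transpose (h : planesDisjoint i j k l) (c s : R) :
    (doubleRot i j k l c s)ᵀ = doubleRot i j k l c (-s) := by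
  obtain ⟨h1, h2, h3, h4, h5, h6⟩ := h
  ext a b
  simp only [doubleRot, Matrix.of_apply, Matrix.transpose_apply]
  grind

theorem doubleRot_transpose_mul_self (h : planesDisjoint i j k l) {c s : R}
    (hcs : c ^ 2 + s ^ 2 = 1) :
    (doubleRot i j k l c s)ᵀ * doubleRot i j k l c s = 1 := by
  rw [doubleRot_transpose h, doubleRot_mul h, ← doubleRot_one_zero (i := i) (j := j)]
  congr 1
  · linear_combination hcs
  · ring

theorem doubleRot_map {S : Type*} [CommRing S] (f : R →+* S) (c s : R) :
    (doubleRot i j k l c s).map f = doubleRot i j k l (f c) (f s) := by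
  ext a b
  simp only [doubleRot, Matrix.of_apply, Matrix.map_apply]
  split_ifs <;> simp

end doubleRot

set_option maxHeartbeats 1600000 in
theorem doubleRot_octMul {i j k l : Fin 8} (h : autPlanes i j k l) {c s : ℂ}
    (hcs : c ^ 2 + s ^ 2 = 1) (x y : Fin 8 → ℂ) :
    doubleRot i j k l c s *ᵥ octMul x y =
      octMul (doubleRot i j k l c s *ᵥ x) (doubleRot i j k l c s *ᵥ y) := by
  have hc : c ^ 2 = 1 - s ^ 2 := by linear_combination hcs
  have hd := h.disjoint
  simp only [octMul_eq]
  funext a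
  simp only [doubleRot_mulVec hd]
  clear hd hcs
  simp only [autPlanes, List.mem_cons, Prod.mk.injEq, List.not_mem_nil, or_false] at h
  rcases h with h | h | h | h | h | h <;> obtain ⟨rfl, rfl, rfl, rfl⟩ := h <;>
    fin_cases a <;> simp <;> ring_nf <;> simp only [hc] <;> ring

theorem doubleRot_inG2cpt {i j k l : Fin 8} (h : autPlanes i j k l) (θ : ℝ) :
    inG2cpt ((doubleRot i j k l (Real.cos θ) (Real.sin θ)).map Complex.ofRealHom) := by
  have hd := h.disjoint
  refine ⟨⟨⟨?_, ?_⟩, fun x y => ?_⟩, fun a b => by simp⟩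
  · rw [← Matrix.transpose_map, ← Matrix.map_mul,
      doubleRot_transpose_mul_self hd (Real.cos_sq_add_sin_sq θ)]
    simp
  · have hhalf : doubleRot i j k l (Real.cos θ) (Real.sin θ) =
        doubleRot i j k l (Real.cos (θ / 2)) (Real.sin (θ / 2)) *
          doubleRot i j k l (Real.cos (θ / 2)) (Real.sin (θ / 2)) := by
      rw [doubleRot_mul hd, ← Real.cos_add, add_comm (Real.cos _ * _), ← Real.sin_add,
        add_halves]
    have hdet := congrArg Matrix.det
      (doubleRot_transpose_mul_self hd (Real.cos_sq_add_sin_sq (θ / 2)))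
    rw [det_mul, det_transpose, det_one, ← det_mul, ← hhalf] at hdet
    have := RingHom.map_det Complex.ofRealHom (doubleRot i j k l (Real.cos θ) (Real.sin θ))
    rw [hdet, map_one] at this
    exact this.symm
  · rw [doubleRot_map]
    refine doubleRot_octMul h ?_ x y
    rw [← map_pow, ← map_pow, ← map_add, Real.cos_sq_add_sin_sq, map_one]

/-- A double rotation kills a given coordinate of a real vector. -/
theorem exists_kill_coord {i j k l : Fin 8} (h : autPlanes i j k l) (a : Fin 8 → ℝ) :
    ∃ g : Matrix (Fin 8) (Fin 8) ℝ, inG2cpt (g.map Complex.ofRealHom) ∧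
      (g *ᵥ a) j = 0 ∧ 0 ≤ (g *ᵥ a) i ∧
      (a k = 0 → a l = 0 → (g *ᵥ a) k = 0 ∧ (g *ᵥ a) l = 0) ∧
      (∀ b : Fin 8 → ℝ, ∀ m, m ≠ i → m ≠ j → m ≠ k → m ≠ l → (g *ᵥ b) m = b m) ∧
      ∀ m, m ≠ i → m ≠ j → m ≠ k → m ≠ l →
        g *ᵥ (Pi.single m 1 : Fin 8 → ℝ) = Pi.single m 1 := by
  set z : ℂ := ⟨a i, a j⟩ with hz
  have hre : ‖z‖ * Real.cos z.arg = a i := Complex.norm_mul_cos_arg z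
  have him : ‖z‖ * Real.sin z.arg = a j := Complex.norm_mul_sin_arg z
  have hd := h.disjoint
  refine ⟨_, doubleRot_inG2cpt h z.arg, ?_, ?_, ?_, ?_, ?_⟩
  · rw [doubleRot_mulVec hd, if_neg hd.1.symm, if_pos rfl, ← hre, ← him]
    ring
  · rw [doubleRot_mulVec hd, if_pos rfl, ← hre, ← him]
    have := Real.cos_sq_add_sin_sq z.arg
    calc 0 ≤ ‖z‖ := norm_nonneg z
      _ = _ := by linear_combination -‖z‖ * this
  · intro hk hl
    obtain ⟨h1, h2, h3, h4, h5, h6⟩ := hd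
    constructor <;> rw [doubleRot_mulVec h.disjoint] <;>
      simp [h2.symm, h3.symm, h4.symm, h5.symm, h6.symm, hk, hl]
  · intro b m hi hj hk hl
    rw [doubleRot_mulVec hd]
    simp [hi, hj, hk, hl]
  · intro m hi hj hk hl
    funext b
    rw [doubleRot_mulVec hd]
    simp only [Pi.single_apply]
    grind

/-- The stabilizer of `e₁` in `G₂` moves every imaginary real vector into the span of `e₁`
and `e₂`. -/
theorem exists_stabilizer_move (a : Fin 8 → ℝ) (ha : a 0 = 0) :
    ∃ g : Matrix (Fin 8) (Fin 8) ℝ, inG2cpt (g.map Complex.ofRealHom) ∧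
      (∀ b : Fin 8 → ℝ, (g *ᵥ b) 0 = b 0) ∧
      g *ᵥ (Pi.single 1 1 : Fin 8 → ℝ) = Pi.single 1 1 ∧
      ∃ p q : ℝ, g *ᵥ a = ![0, p, q, 0, 0, 0, 0, 0] := by
  obtain ⟨g₁, h₁, z₁, -, -, f₁, s₁⟩ :=
    exists_kill_coord (i := 6) (j := 7) (k := 5) (l := 4) (by simp [autPlanes]) a
  obtain ⟨g₂, h₂, z₂, -, -, f₂, s₂⟩ :=
    exists_kill_coord (i := 4) (j := 5) (k := 3) (l := 2) (by simp [autPlanes]) (g₁ *ᵥ a)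
  obtain ⟨g₃, h₃, z₃, -, t₃, f₃, s₃⟩ :=
    exists_kill_coord (i := 4) (j := 6) (k := 5) (l := 7) (by simp [autPlanes])
      (g₂ *ᵥ g₁ *ᵥ a)
  obtain ⟨g₄, h₄, z₄, -, t₄, f₄, s₄⟩ :=
    exists_kill_coord (i := 2) (j := 3) (k := 7) (l := 6) (by simp [autPlanes])
      (g₃ *ᵥ g₂ *ᵥ g₁ *ᵥ a)
  obtain ⟨g₅, h₅, z₅, -, t₅, f₅, s₅⟩ :=
    exists_kill_coord (i := 2) (j := 4) (k := 3) (l := 5) (by simp [autPlanes])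
      (g₄ *ᵥ g₃ *ᵥ g₂ *ᵥ g₁ *ᵥ a)
  have e₀ : (g₅ *ᵥ g₄ *ᵥ g₃ *ᵥ g₂ *ᵥ g₁ *ᵥ a) 0 = 0 := by
    rw [f₅, f₄, f₃, f₂, f₁, ha] <;> decide
  have w₇ : (g₂ *ᵥ g₁ *ᵥ a) 7 = 0 := by rw [f₂, z₁] <;> decide
  obtain ⟨x₅, x₇⟩ := t₃ z₂ w₇
  obtain ⟨y₇, y₆⟩ := t₄ x₇ z₃
  have y₅ : (g₄ *ᵥ g₃ *ᵥ g₂ *ᵥ g₁ *ᵥ a) 5 = 0 := by rw [f₄, x₅] <;> decide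
  obtain ⟨u₃, u₅⟩ := t₅ z₄ y₅
  have u₆ : (g₅ *ᵥ g₄ *ᵥ g₃ *ᵥ g₂ *ᵥ g₁ *ᵥ a) 6 = 0 := by rw [f₅, y₆] <;> decide
  have u₇ : (g₅ *ᵥ g₄ *ᵥ g₃ *ᵥ g₂ *ᵥ g₁ *ᵥ a) 7 = 0 := by rw [f₅, y₇] <;> decide
  refine ⟨g₅ * (g₄ * (g₃ * (g₂ * g₁))), ?_, fun b => ?_, ?_,
    (g₅ *ᵥ g₄ *ᵥ g₃ *ᵥ g₂ *ᵥ g₁ *ᵥ a) 1,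
    (g₅ *ᵥ g₄ *ᵥ g₃ *ᵥ g₂ *ᵥ g₁ *ᵥ a) 2, ?_⟩
  · simp only [Matrix.map_mul]
    exact h₅.mul (h₄.mul (h₃.mul (h₂.mul h₁)))
  · simp only [← mulVec_mulVec]
    rw [f₅, f₄, f₃, f₂, f₁] <;> decide
  · simp only [← mulVec_mulVec]
    rw [s₁, s₂, s₃, s₄, s₅] <;> decide
  · simp only [← mulVec_mulVec]
    funext m
    fin_cases m <;> simp [-mulVec_mulVec, e₀, u₃, z₅, u₅, u₆, u₇]

/-- `G₂` moves every imaginary real vector to a nonnegative multiple of `e₁`. -/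
theorem exists_move_to_ray (a : Fin 8 → ℝ) (ha : a 0 = 0) :
    ∃ g : Matrix (Fin 8) (Fin 8) ℝ, inG2cpt (g.map Complex.ofRealHom) ∧
      (∀ b : Fin 8 → ℝ, (g *ᵥ b) 0 = b 0) ∧
      ∃ r : ℝ, 0 ≤ r ∧ g *ᵥ a = r • Pi.single 1 1 := by
  obtain ⟨g, hg, hg₀, -, p, q, hpq⟩ := exists_stabilizer_move a ha
  obtain ⟨g', hg', z, hr, t, f, -⟩ :=
    exists_kill_coord (i := 1) (j := 2) (k := 7) (l := 4) (by simp [autPlanes]) (g *ᵥ a)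
  refine ⟨g' * g, by rw [Matrix.map_mul]; exact hg'.mul hg, fun b => ?_, _, hr, ?_⟩
  · rw [← mulVec_mulVec, f, hg₀] <;> decide
  rw [← mulVec_mulVec]
  obtain ⟨t₇, t₄⟩ := t (by simp [hpq]) (by simp [hpq])
  have f₀ := f (g *ᵥ a) 0 (by decide) (by decide) (by decide) (by decide)
  have f₃ := f (g *ᵥ a) 3 (by decide) (by decide) (by decide) (by decide)
  have f₅ := f (g *ᵥ a) 5 (by decide) (by decide) (by decide) (by decide)
  have f₆ := f (g *ᵥ a) 6 (by decide) (by decide) (by decide) (by decide)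
  rw [hpq] at *
  funext m
  fin_cases m <;> simp_all

theorem bform_mulVec {g : Matrix (Fin 8) (Fin 8) ℂ} (hg : gᵀ * g = 1) (v w : Fin 8 → ℂ) :
    bform (g *ᵥ v) (g *ᵥ w) = bform v w := by
  change g *ᵥ v ⬝ᵥ g *ᵥ w = v ⬝ᵥ w
  rw [dotProduct_mulVec, vecMul_mulVec, ← dotProduct_mulVec, hg, one_mulVec]

theorem map_ofReal_mulVec (g : Matrix (Fin 8) (Fin 8) ℝ) (v : Fin 8 → ℂ) (m : Fin 8) :
    (g.map Complex.ofRealHom *ᵥ v) m =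
      ((g *ᵥ fun n => (v n).re) m : ℂ) + Complex.I * ((g *ᵥ fun n => (v n).im) m : ℂ) := by
  simp only [mulVec, dotProduct, Matrix.map_apply, Complex.ofReal_sum, Finset.mul_sum,
    ← Finset.sum_add_distrib]
  refine Finset.sum_congr rfl fun n _ => ?_
  conv_lhs => rw [← Complex.re_add_im (v n)]
  simp only [Complex.ofRealHom_eq_coe, Complex.ofReal_mul]
  ring

/-- **Lemma `lem:g2-sphere`.** Every point of the complex unit sphere `S_ℂ^6` lies in
the `G₂`-orbit of the slice `T₁ = {cosh θ · e₁ + i sinh θ · e₂ : θ ∈ ℝ}`: for every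
`v ∈ ℂ^8` with `v₀ = 0` and `(v, v) = 1` there exist `k ∈ G₂` (the real form of
`G₂(ℂ)`) and `θ ∈ ℝ` with `v = k (cosh θ · e₁ + i sinh θ · e₂)`. -/
theorem stmt7 (v : Fin 8 → ℂ) (hv0 : v 0 = 0) (hv : bform v v = 1) :
    ∃ (k : Matrix (Fin 8) (Fin 8) ℂ) (θ : ℝ), inG2cpt k ∧
      v = k.mulVec ((Real.cosh θ : ℂ) • e 1 + (Complex.I * (Real.sinh θ : ℂ)) • e 2) := by
  obtain ⟨g₁, h₁, hf, r, hr, hr₁⟩ := exists_move_to_ray (fun n => (v n).re) (by simp [hv0])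
  obtain ⟨g₂, h₂, -, hs, p, q, hpq⟩ :=
    exists_stabilizer_move (g₁ *ᵥ fun n => (v n).im) (by simp [hf, hv0])
  have hg : inG2cpt ((g₂ * g₁).map Complex.ofRealHom) := by
    rw [Matrix.map_mul]
    exact h₂.mul h₁
  have hgv : (g₂ * g₁).map Complex.ofRealHom *ᵥ v =
      ![0, r + Complex.I * p, Complex.I * q, 0, 0, 0, 0, 0] := by
    funext m
    rw [map_ofReal_mulVec, ← mulVec_mulVec, ← mulVec_mulVec, hr₁, mulVec_smul, hs, hpq]
    fin_cases m <;> simp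
  have hnorm := bform_mulVec hg.1.1.1 v v
  rw [hgv, hv] at hnorm
  simp only [bform, Fin.sum_univ_eight] at hnorm
  have hre := congrArg Complex.re hnorm
  have him := congrArg Complex.im hnorm
  simp at hre him
  have hp : p = 0 := by
    by_contra hp
    have : r = 0 := by
      have : r * p = 0 := by linarith
      simpa [hp] using this
    subst this
    nlinarith [sq_nonneg p, sq_nonneg q]
  subst hp
  have hcosh : Real.cosh (Real.arsinh q) = r := by
    rw [Real.cosh_arsinh, Real.sqrt_eq_iff_eq_sq (by positivity) hr]
    linarith
  refine ⟨_, Real.arsinh q, hg.transpose, ?_⟩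
  rw [hcosh, Real.sinh_arsinh]
  have : (r : ℂ) • e 1 + (Complex.I * (q : ℂ)) • e 2 =
      (g₂ * g₁).map Complex.ofRealHom *ᵥ v := by
    rw [hgv]
    funext m
    fin_cases m <;> simp [e]
  rw [this, mulVec_mulVec, hg.1.1.1, one_mulVec]
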